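/- arXiv:2307.04345 — 6 statements merged into one kernel-verified Lean document; each statement's English description precedes it below -/
import Mathlib

section
/- Suppose Y and U are conditionally independent given H, and let P be any random probability mass function on 𝒴 that is measurable with respect to σ(U) and satisfies P(y) > 0 for all y ∈ 𝒴 almost surely. Then the expected prediction error decomposes exactly into informational and inferential components: E[d_KL(P*‖P)] = E[d_KL(P*‖P̃)] + E[d_KL(P̃‖P)]. -/
open MeasureTheory

/-- The probability mass function of a random variable `X` under `μ`. -/
noncomputable def pmfOf {Ω α : Type*} [MeasurableSpace Ω] (μ : Measure Ω) (X : Ω → α)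
    (x : α) : ℝ :=
  (μ (X ⁻¹' {x})).toReal

/-- The (random) conditional pmf `ω ↦ ℙ(Y = y | H = H ω)`. -/
noncomputable def condPMF {Ω α β : Type*} [MeasurableSpace Ω] (μ : Measure Ω)
    (Y : Ω → α) (H : Ω → β) (y : α) (ω : Ω) : ℝ :=
  (μ (Y ⁻¹' {y} ∩ H ⁻¹' {H ω})).toReal / (μ (H ⁻¹' {H ω})).toReal

/-- Kullback–Leibler divergence between two pmfs on a finite type (in nats). -/
noncomputable def klDiv' {α : Type*} [Fintype α] (p q : α → ℝ) : ℝ :=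
  ∑ y, p y * Real.log (p y / q y)

/-- The expectation of a function of two finitely-valued random variables. -/
lemma integral_comp_pair_eq_sum {Ω α β : Type*} [MeasurableSpace Ω]
    [Fintype α] [MeasurableSpace α] [MeasurableSingletonClass α]
    [Fintype β] [MeasurableSpace β] [MeasurableSingletonClass β]
    (μ : Measure Ω) [IsFiniteMeasure μ] {X : Ω → α} {Z : Ω → β}
    (hX : Measurable X) (hZ : Measurable Z) (F : α → β → ℝ) :
    ∫ ω, F (X ω) (Z ω) ∂μ = ∑ z, ∑ x, μ.real (Z ⁻¹' {z} ∩ X ⁻¹' {x}) * F x z := by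
  have hXZ : Measurable fun ω => (X ω, Z ω) := hX.prodMk hZ
  rw [← integral_map (f := fun p : α × β => F p.1 p.2) hXZ.aemeasurable
    Measurable.of_discrete.aestronglyMeasurable, integral_fintype .of_finite,
    Fintype.sum_prod_type_right]
  refine Finset.sum_congr rfl fun z _ => Finset.sum_congr rfl fun x _ => ?_
  rw [map_measureReal_apply hXZ (measurableSet_singleton _), smul_eq_mul]
  congr 2
  ext ω
  simp [and_comm]

/-- Summing the masses of `s ∩ {X = x}` over all values `x` gives the mass of `s`. -/
lemma sum_measureReal_inter_preimage {Ω α : Type*} [MeasurableSpace Ω]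
    [Fintype α] [MeasurableSpace α] [MeasurableSingletonClass α]
    (μ : Measure Ω) [IsFiniteMeasure μ] {X : Ω → α} (hX : Measurable X) (s : Set Ω) :
    ∑ x, μ.real (s ∩ X ⁻¹' {x}) = μ.real s := by
  have h := sum_measureReal_preimage_singleton (μ := μ.restrict s) (f := X) Finset.univ
    fun x _ => hX (measurableSet_singleton x)
  simpa [measureReal_restrict_apply, hX (measurableSet_singleton _), Set.inter_comm] using h

/-- Suppose `Y` and `U` are conditionally independent given `H`, and let `P` be any random pmf
on `𝒴` that is measurable with respect to `σ(U)` (i.e. factors through `U` as `g`) and satisfies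
`P(y) > 0` for all `y` almost surely.  Then the expected prediction error decomposes exactly
into informational and inferential components:
`E[d_KL(P*‖P)] = E[d_KL(P*‖P̃)] + E[d_KL(P̃‖P)]`. -/
theorem prediction_error_decomposition
    {Ω 𝒴 ℋ 𝒰 : Type*} [MeasurableSpace Ω]
    [Fintype 𝒴] [Nonempty 𝒴] [MeasurableSpace 𝒴] [MeasurableSingletonClass 𝒴]
    [Fintype ℋ] [Nonempty ℋ] [MeasurableSpace ℋ] [MeasurableSingletonClass ℋ]
    [Fintype 𝒰] [Nonempty 𝒰] [MeasurableSpace 𝒰] [MeasurableSingletonClass 𝒰]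
    (μ : Measure Ω) [IsProbabilityMeasure μ]
    (Y : Ω → 𝒴) (H : Ω → ℋ) (U : Ω → 𝒰)
    (hY : Measurable Y) (hH : Measurable H) (hU : Measurable U)
    (hCI : ∀ (y : 𝒴) (u : 𝒰) (h : ℋ),
      (μ (Y ⁻¹' {y} ∩ U ⁻¹' {u} ∩ H ⁻¹' {h})).toReal * (μ (H ⁻¹' {h})).toReal
        = (μ (Y ⁻¹' {y} ∩ H ⁻¹' {h})).toReal * (μ (U ⁻¹' {u} ∩ H ⁻¹' {h})).toReal)
    (g : 𝒰 → 𝒴 → ℝ)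
    (hg_nonneg : ∀ u y, 0 ≤ g u y) (hg_sum : ∀ u, ∑ y, g u y = 1)
    (hg_pos : ∀ᵐ ω ∂μ, ∀ y, 0 < g (U ω) y) :
    ∫ ω, klDiv' (fun y => condPMF μ Y H y ω) (fun y => g (U ω) y) ∂μ
      = ∫ ω, klDiv' (fun y => condPMF μ Y H y ω) (fun y => condPMF μ Y U y ω) ∂μ
        + ∫ ω, klDiv' (fun y => condPMF μ Y U y ω) (fun y => g (U ω) y) ∂μ := by
  have hmono {s t : Set Ω} (hst : s ⊆ t) (ht : μ.real t = 0) : μ.real s = 0 :=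
    measureReal_mono_null hst ht
  set a : ℋ → 𝒴 → ℝ := fun h y => μ.real (Y ⁻¹' {y} ∩ H ⁻¹' {h}) / μ.real (H ⁻¹' {h}) with ha
  set b : 𝒰 → 𝒴 → ℝ := fun u y => μ.real (Y ⁻¹' {y} ∩ U ⁻¹' {u}) / μ.real (U ⁻¹' {u}) with hb
  have hjoint (y : 𝒴) (u : 𝒰) (h : ℋ) :
      μ.real (U ⁻¹' {u} ∩ H ⁻¹' {h}) * a h y
        = μ.real (Y ⁻¹' {y} ∩ U ⁻¹' {u} ∩ H ⁻¹' {h}) := by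
    by_cases h0 : μ.real (H ⁻¹' {h}) = 0
    · rw [hmono Set.inter_subset_right h0, hmono Set.inter_subset_right h0, zero_mul]
    · have := hCI y u h
      simp only [← measureReal_def] at this
      simp only [ha]
      field_simp
      linarith
  have hmean (y : 𝒴) (u : 𝒰) :
      ∑ h, μ.real (U ⁻¹' {u} ∩ H ⁻¹' {h}) * a h y
        = ∑ h, μ.real (U ⁻¹' {u} ∩ H ⁻¹' {h}) * b u y := by
    simp only [hjoint]
    rw [← Finset.sum_mul, sum_measureReal_inter_preimage μ hH,
      sum_measureReal_inter_preimage μ hH]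
    by_cases h0 : μ.real (U ⁻¹' {u}) = 0
    · rw [hmono Set.inter_subset_right h0, h0, zero_mul]
    · simp only [hb]
      field_simp
  have hterm (y : 𝒴) (u : 𝒰) (h : ℋ) :
      μ.real (U ⁻¹' {u} ∩ H ⁻¹' {h}) * (a h y * Real.log (a h y / g u y))
        = μ.real (U ⁻¹' {u} ∩ H ⁻¹' {h}) * (a h y * Real.log (a h y / b u y))
          + μ.real (U ⁻¹' {u} ∩ H ⁻¹' {h}) * a h y * Real.log (b u y / g u y) := by
    by_cases hma : μ.real (U ⁻¹' {u} ∩ H ⁻¹' {h}) * a h y = 0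
    · simp only [← mul_assoc, hma, zero_mul, add_zero]
    have ha0 : a h y ≠ 0 := right_ne_zero_of_mul hma
    have hu0 : μ.real (U ⁻¹' {u}) ≠ 0 := fun h0 =>
      left_ne_zero_of_mul hma (hmono Set.inter_subset_left h0)
    have hb0 : b u y ≠ 0 := by
      refine div_ne_zero (fun h0 => hma ?_) hu0
      rw [hjoint]
      exact hmono Set.inter_subset_left h0
    have hg0 : g u y ≠ 0 := by
      intro h0
      refine hu0 ((measureReal_eq_zero_iff).2 (measure_mono_null ?_ (ae_iff.1 hg_pos)))
      rintro ω rfl hω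
      exact (hω y).ne' h0
    rw [Real.log_div ha0 hg0, Real.log_div ha0 hb0, Real.log_div hb0 hg0]
    ring
  have hPg := integral_comp_pair_eq_sum μ hH hU fun h u => klDiv' (a h) (g u)
  have hPb := integral_comp_pair_eq_sum μ hH hU fun h u => klDiv' (a h) (b u)
  have hbg := integral_comp_pair_eq_sum μ hH hU fun _ u => klDiv' (b u) (g u)
  refine hPg.trans ((congrArg₂ (· + ·) hPb hbg).trans ?_).symm
  simp only [klDiv', Finset.mul_sum]
  rw [← Finset.sum_add_distrib]
  refine Finset.sum_congr rfl fun u _ => ?_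
  rw [Finset.sum_comm, Finset.sum_comm (s := Finset.univ (α := ℋ)),
    Finset.sum_comm (s := Finset.univ (α := ℋ)), ← Finset.sum_add_distrib]
  refine Finset.sum_congr rfl fun y _ => ?_
  simp only [hterm, Finset.sum_add_distrib]
  simp only [← mul_assoc, ← Finset.sum_mul, hmean]
end

section
/- Suppose Y and U are conditionally independent given H. Then the expected informational error equals the information about Y contained in the history H but absent from the agent state U: E[d_KL(P*‖P̃)] = I(Y; H | U). -/
open MeasureTheory

/-- Shannon entropy (in nats) of a finite-valued random variable. -/
noncomputable def entropy' {Ω α : Type*} [MeasurableSpace Ω] [Fintype α]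
    (μ : Measure Ω) (X : Ω → α) : ℝ :=
  ∑ x, Real.negMulLog (pmfOf μ X x)

/-- Shannon mutual information (in nats) between two finite-valued random variables. -/
noncomputable def mi' {Ω α β : Type*} [MeasurableSpace Ω] [Fintype α] [Fintype β]
    (μ : Measure Ω) (X : Ω → α) (Y : Ω → β) : ℝ :=
  entropy' μ X + entropy' μ Y - entropy' μ (fun ω => (X ω, Y ω))

/-- Shannon conditional mutual information `I(X; Y | Z)` (in nats). -/
noncomputable def cmi' {Ω α β γ : Type*} [MeasurableSpace Ω] [Fintype α] [Fintype β] [Fintype γ]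
    (μ : Measure Ω) (X : Ω → α) (Y : Ω → β) (Z : Ω → γ) : ℝ :=
  entropy' μ (fun ω => (X ω, Z ω)) + entropy' μ (fun ω => (Y ω, Z ω))
    - entropy' μ (fun ω => (X ω, Y ω, Z ω)) - entropy' μ Z

/-- Law of the unconscious statistician for a finite-valued random variable. -/
theorem integral_comp_eq_sum_pmfOf {Ω α : Type*} [MeasurableSpace Ω] [Fintype α]
    [MeasurableSpace α] [MeasurableSingletonClass α] (μ : Measure Ω) [IsFiniteMeasure μ]
    {X : Ω → α} (hX : Measurable X) (g : α → ℝ) :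
    ∫ ω, g (X ω) ∂μ = ∑ x, pmfOf μ X x * g x := by
  rw [← integral_map hX.aemeasurable (measurable_of_finite g).aestronglyMeasurable,
    integral_fintype .of_finite]
  refine Finset.sum_congr rfl fun x _ => ?_
  rw [measureReal_def, Measure.map_apply hX (measurableSet_singleton x), smul_eq_mul, pmfOf]

/-- The entropy of a function of `X`, as a sum over the values of `X`. -/
theorem entropy'_comp_eq_sum {Ω α β : Type*} [MeasurableSpace Ω] [Fintype α]
    [MeasurableSpace α] [MeasurableSingletonClass α] [Fintype β]
    [MeasurableSpace β] [MeasurableSingletonClass β] (μ : Measure Ω) [IsFiniteMeasure μ]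
    {X : Ω → α} (hX : Measurable X) (f : α → β) :
    entropy' μ (fun ω => f (X ω))
      = -∑ x, pmfOf μ X x * Real.log (pmfOf μ (fun ω => f (X ω)) (f x)) := by
  have hfX : Measurable fun ω => f (X ω) := (measurable_of_finite f).comp hX
  rw [← integral_comp_eq_sum_pmfOf μ hX
      (fun x => Real.log (pmfOf μ (fun ω => f (X ω)) (f x))),
    integral_comp_eq_sum_pmfOf μ hfX
      (fun z => Real.log (pmfOf μ (fun ω => f (X ω)) z)), ← Finset.sum_neg_distrib]
  simp only [entropy', Real.negMulLog, neg_mul]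

theorem pmfOf_prodMk {Ω α β : Type*} [MeasurableSpace Ω] (μ : Measure Ω)
    (X : Ω → α) (Z : Ω → β) (x : α) (z : β) :
    pmfOf μ (fun ω => (X ω, Z ω)) (x, z) = (μ (X ⁻¹' {x} ∩ Z ⁻¹' {z})).toReal := by
  rw [pmfOf]
  congr 2
  ext ω
  simp

/-- The probability of a joint value is at most that of any function of it. -/
theorem pmfOf_le_pmfOf_comp {Ω α β : Type*} [MeasurableSpace Ω] (μ : Measure Ω)
    [IsFiniteMeasure μ] (X : Ω → α) (f : α → β) (x : α) :
    pmfOf μ X x ≤ pmfOf μ (fun ω => f (X ω)) (f x) :=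
  ENNReal.toReal_mono (measure_ne_top _ _)
    (measure_mono fun _ hω => congrArg f (Set.mem_singleton_iff.mp hω))

/-- Pointwise form of the identity: `a, b, c, d, e, q` play the roles of the probabilities of
`(y, h, u)`, `(y, h)`, `(h, u)`, `(y, u)`, `h`, `u`. -/
theorem mul_div_mul_log_div_eq {a b c d e q : ℝ} (h : a * e = b * c) (ha : 0 ≤ a)
    (hb : a ≤ b) (hc : a ≤ c) (hd : a ≤ d) (he : c ≤ e) (hq : a ≤ q) :
    c * (b / e * Real.log (b / e / (d / q)))
      = a * (Real.log a + Real.log q - Real.log c - Real.log d) := by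
  rcases ha.eq_or_lt with rfl | ha
  · have : b = 0 ∨ c = 0 := by simpa using h.symm
    rcases this with rfl | rfl <;> simp
  · have hc' := ha.trans_le hc
    have he' := hc'.trans_le he
    have hd' := ha.trans_le hd
    have hq' := ha.trans_le hq
    have hbe : b / e = a / c := by
      rw [div_eq_div_iff he'.ne' hc'.ne', h]
    rw [hbe, Real.log_div (by positivity) (by positivity), Real.log_div ha.ne' hc'.ne',
      Real.log_div hd'.ne' hq'.ne']
    field_simp
    ring

/-- Suppose `Y` and `U` are conditionally independent given `H`. Then the expected informational
error equals the information about `Y` contained in the history `H` but absent from the agent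
state `U`: `E[d_KL(P*‖P̃)] = I(Y; H | U)`. -/
theorem informational_error_eq_absent_information
    {Ω 𝒴 ℋ 𝒰 : Type*} [MeasurableSpace Ω]
    [Fintype 𝒴] [Nonempty 𝒴] [MeasurableSpace 𝒴] [MeasurableSingletonClass 𝒴]
    [Fintype ℋ] [Nonempty ℋ] [MeasurableSpace ℋ] [MeasurableSingletonClass ℋ]
    [Fintype 𝒰] [Nonempty 𝒰] [MeasurableSpace 𝒰] [MeasurableSingletonClass 𝒰]
    (μ : Measure Ω) [IsProbabilityMeasure μ]
    (Y : Ω → 𝒴) (H : Ω → ℋ) (U : Ω → 𝒰)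
    (hY : Measurable Y) (hH : Measurable H) (hU : Measurable U)
    (hCI : ∀ (y : 𝒴) (u : 𝒰) (h : ℋ),
      (μ (Y ⁻¹' {y} ∩ U ⁻¹' {u} ∩ H ⁻¹' {h})).toReal * (μ (H ⁻¹' {h})).toReal
        = (μ (Y ⁻¹' {y} ∩ H ⁻¹' {h})).toReal * (μ (U ⁻¹' {u} ∩ H ⁻¹' {h})).toReal) :
    ∫ ω, klDiv' (fun y => condPMF μ Y H y ω) (fun y => condPMF μ Y U y ω) ∂μ
      = cmi' μ Y H U := by
  have hW : Measurable fun ω => (Y ω, H ω, U ω) := hY.prodMk (hH.prodMk hU)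
  have hYU := entropy'_comp_eq_sum μ hW fun w => (w.1, w.2.2)
  have hHU := entropy'_comp_eq_sum μ hW fun w => (w.2.1, w.2.2)
  have hYHU := entropy'_comp_eq_sum μ hW fun w => (w.1, w.2.1, w.2.2)
  have hU' := entropy'_comp_eq_sum μ hW fun w => w.2.2
  dsimp only at hYU hHU hYHU hU'
  rw [cmi', hYU, hHU, hYHU, hU']
  refine (integral_comp_eq_sum_pmfOf μ (hH.prodMk hU) fun z => klDiv'
    (fun y => (μ (Y ⁻¹' {y} ∩ H ⁻¹' {z.1})).toReal / (μ (H ⁻¹' {z.1})).toReal)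
    (fun y => (μ (Y ⁻¹' {y} ∩ U ⁻¹' {z.2})).toReal / (μ (U ⁻¹' {z.2})).toReal)).trans ?_
  have key : ∀ w : 𝒴 × ℋ × 𝒰, _ := fun w =>
    mul_div_mul_log_div_eq (a := pmfOf μ (fun ω => (Y ω, H ω, U ω)) w)
      (b := pmfOf μ (fun ω => (Y ω, H ω)) (w.1, w.2.1))
      (c := pmfOf μ (fun ω => (H ω, U ω)) (w.2.1, w.2.2))
      (d := pmfOf μ (fun ω => (Y ω, U ω)) (w.1, w.2.2))
      (e := pmfOf μ H w.2.1) (q := pmfOf μ U w.2.2)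
      (by
        obtain ⟨y, h, u⟩ := w
        have hset : Y ⁻¹' {y} ∩ U ⁻¹' {u} ∩ H ⁻¹' {h}
            = (fun ω => (Y ω, H ω, U ω)) ⁻¹' {(y, h, u)} := by
          ext ω
          simp only [Set.mem_inter_iff, Set.mem_preimage, Set.mem_singleton_iff, Prod.mk.injEq]
          tauto
        have := hCI y u h
        rw [hset, Set.inter_comm (U ⁻¹' {u})] at this
        rw [pmfOf_prodMk μ Y H, pmfOf_prodMk μ H U]
        exact this)
      ENNReal.toReal_nonneg
      (pmfOf_le_pmfOf_comp μ (fun ω => (Y ω, H ω, U ω)) (fun w => (w.1, w.2.1)) w)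
      (pmfOf_le_pmfOf_comp μ (fun ω => (Y ω, H ω, U ω)) (fun w => w.2) w)
      (pmfOf_le_pmfOf_comp μ (fun ω => (Y ω, H ω, U ω)) (fun w => (w.1, w.2.2)) w)
      (pmfOf_le_pmfOf_comp μ (fun ω => (H ω, U ω)) Prod.fst w.2)
      (pmfOf_le_pmfOf_comp μ (fun ω => (Y ω, H ω, U ω)) (fun w => w.2.2) w)
  have hsum := Finset.sum_congr (rfl : (Finset.univ : Finset (𝒴 × ℋ × 𝒰)) = _) fun w _ => key w
  simp only [mul_add, mul_sub, Finset.sum_add_distrib, Finset.sum_sub_distrib] at hsum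
  trans ∑ w : 𝒴 × ℋ × 𝒰, pmfOf μ (fun ω => (H ω, U ω)) (w.2.1, w.2.2) *
      (pmfOf μ (fun ω => (Y ω, H ω)) (w.1, w.2.1) / pmfOf μ H w.2.1 *
        Real.log (pmfOf μ (fun ω => (Y ω, H ω)) (w.1, w.2.1) / pmfOf μ H w.2.1 /
          (pmfOf μ (fun ω => (Y ω, U ω)) (w.1, w.2.2) / pmfOf μ U w.2.2)))
  · rw [Fintype.sum_prod_type_right (α₁ := 𝒴)]
    refine Finset.sum_congr rfl fun z _ => ?_
    rw [klDiv', Finset.mul_sum]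
    simp only [pmfOf_prodMk, Prod.mk.eta]
    rfl
  · rw [hsum]
    ring
end

section
/- Under the agent-state property, the informational error decomposes into forgetting and implasticity terms at every lag: I(Y; H_{1:t} | U_t) = Σ_{k=0}^{t−1} [ I(Y; U_{t−k−1} | U_{t−k}, H_{t−k:t}) + I(Y; O_{t−k} | U_{t−k}, H_{t−k+1:t}) ], where the k-th summands are respectively the forgetting error and the implasticity error at lag k. -/
open MeasureTheory

open ProbabilityTheory

theorem exists_eq_of_negMulLog_ne {Ω α : Type*} [MeasurableSpace Ω] {μ : Measure Ω}
    {X : Ω → α} {x : α} (h : Real.negMulLog (pmfOf μ X x) ≠ 0) : ∃ ω, X ω = x := by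
  by_contra! hc
  apply h
  have : X ⁻¹' {x} = ∅ := by
    ext ω
    simp [hc ω]
  simp [pmfOf, this]

/-- Entropy only depends on the partition generated by the random variable. -/
theorem entropy'_congr {Ω α β : Type*} [MeasurableSpace Ω] [Fintype α] [Fintype β]
    (μ : Measure Ω) {X : Ω → α} {X' : Ω → β} (h : ∀ ω ω', X ω = X ω' ↔ X' ω = X' ω') :
    entropy' μ X = entropy' μ X' := by
  classical
  have key : ∀ ω, X ⁻¹' {X ω} = X' ⁻¹' {X' ω} := fun ω => by
    ext ω'
    simp [h]
  unfold entropy'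
  refine Finset.sum_bij_ne_zero (fun x _ hx => X' (exists_eq_of_negMulLog_ne hx).choose)
    ?_ ?_ ?_ ?_
  · intros
    exact Finset.mem_univ _
  · intro a _ ha b _ hb hab
    rw [← (exists_eq_of_negMulLog_ne ha).choose_spec,
      ← (exists_eq_of_negMulLog_ne hb).choose_spec]
    exact (h _ _).2 hab
  · intro b _ hb
    obtain ⟨ω, rfl⟩ := exists_eq_of_negMulLog_ne hb
    have hne : Real.negMulLog (pmfOf μ X (X ω)) ≠ 0 := by
      simpa only [pmfOf, key] using hb
    exact ⟨X ω, Finset.mem_univ _, hne, (h _ _).1 (exists_eq_of_negMulLog_ne hne).choose_spec⟩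
  · intro a _ ha
    simp only [pmfOf]
    rw [← key, (exists_eq_of_negMulLog_ne ha).choose_spec]

theorem sum_pmfOf_prod {Ω α β : Type*} [MeasurableSpace Ω]
    [Fintype α] [MeasurableSpace α] [MeasurableSingletonClass α]
    [MeasurableSpace β] [MeasurableSingletonClass β]
    (μ : Measure Ω) [IsProbabilityMeasure μ] {X : Ω → α} {Z : Ω → β}
    (hX : Measurable X) (hZ : Measurable Z) (z : β) :
    ∑ x, pmfOf μ (fun ω => (X ω, Z ω)) (x, z) = pmfOf μ Z z := by
  classical
  have := measureReal_biUnion_finset (μ := μ) (s := Finset.univ)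
    (f := fun x => (fun ω => (X ω, Z ω)) ⁻¹' {(x, z)})
    (by
      intro a _ b _ hab
      refine Set.disjoint_left.2 fun ω h1 h2 => hab ?_
      simp_all)
    (fun x _ => (hX.prodMk hZ) (measurableSet_singleton _))
  simp only [pmfOf, ← measureReal_def]
  rw [← this]
  congr 1
  ext ω
  simp

/-- The conditional entropy of `V` given `W`, when `V = g W X` with `X` independent of `W`. -/
theorem entropy'_prod_sub_of_indepFun {Ω α β γ : Type*} [MeasurableSpace Ω]
    [Fintype α] [MeasurableSpace α] [MeasurableSingletonClass α] [Fintype β]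
    [Finite γ] [MeasurableSpace γ] [MeasurableSingletonClass γ]
    (μ : Measure Ω) [IsProbabilityMeasure μ] {W : Ω → α} {X : Ω → γ}
    (hX : Measurable X) (h : IndepFun W X μ) (g : α → γ → β) :
    entropy' μ (fun ω => (W ω, g (W ω) (X ω))) - entropy' μ W
      = ∑ w, pmfOf μ W w * ∑ v, Real.negMulLog (pmfOf μ (fun ω => g w (X ω)) v) := by
  classical
  have hp : ∀ w v, pmfOf μ (fun ω => (W ω, g (W ω) (X ω))) (w, v)
      = pmfOf μ W w * pmfOf μ (fun ω => g w (X ω)) v := by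
    intro w v
    have := h.measure_inter_preimage_eq_mul {w} {x | g w x = v} (measurableSet_singleton _)
      (Set.toFinite _).measurableSet
    simp only [pmfOf, ← ENNReal.toReal_mul]
    refine congrArg ENNReal.toReal (Eq.trans (congrArg μ ?_) this)
    ext ω
    simp only [Set.mem_preimage, Set.mem_singleton_iff, Prod.mk.injEq, Set.mem_inter_iff,
      Set.mem_ofPred_eq]
    constructor
    · rintro ⟨rfl, h⟩
      exact ⟨rfl, h⟩
    · rintro ⟨rfl, h⟩
      exact ⟨rfl, h⟩
  have hs : ∀ w, ∑ v, pmfOf μ (fun ω => g w (X ω)) v = 1 := by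
    intro w
    have := measureReal_biUnion_finset (μ := μ) (s := Finset.univ)
      (f := fun v => (fun ω => g w (X ω)) ⁻¹' {v})
      (by
        intro a _ b _ hab
        refine Set.disjoint_left.2 fun ω h1 h2 => hab ?_
        simp_all)
      (fun v _ => hX (Set.toFinite {x | g w x = v}).measurableSet)
    simp only [pmfOf, ← measureReal_def]
    rw [← this]
    convert probReal_univ (μ := μ)
    ext ω
    simp
  unfold entropy'
  rw [Fintype.sum_prod_type, ← Finset.sum_sub_distrib]
  refine Finset.sum_congr rfl fun w _ => ?_
  simp only [hp, Real.negMulLog_mul, Finset.sum_add_distrib, ← Finset.sum_mul, ← Finset.mul_sum, hs]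
  ring

/-- If `V` is a function of `W` and of some `X` independent of `(Y, W)`, then `V` and `Y` are
conditionally independent given `W`, here in terms of entropies. -/
theorem entropy'_markov {Ω δ α β γ ζ : Type*} [MeasurableSpace Ω]
    [Fintype δ] [MeasurableSpace δ] [MeasurableSingletonClass δ]
    [Fintype α] [MeasurableSpace α] [MeasurableSingletonClass α] [Fintype β] [Nonempty β]
    [Finite γ] [MeasurableSpace γ] [MeasurableSingletonClass γ]
    [Finite ζ] [MeasurableSpace ζ] [MeasurableSingletonClass ζ]
    (μ : Measure Ω) [IsProbabilityMeasure μ] {Y : Ω → δ} {W : Ω → α} {V : Ω → β} {X : Ω → γ}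
    {Z : Ω → ζ} (hY : Measurable Y) (hW : Measurable W) (hX : Measurable X)
    (h : IndepFun Z X μ) (hZ : Function.FactorsThrough (fun ω => (Y ω, W ω)) Z)
    (hV : Function.FactorsThrough V (fun ω => (W ω, X ω))) :
    entropy' μ (fun ω => (Y ω, W ω, V ω)) - entropy' μ (fun ω => (W ω, V ω))
      = entropy' μ (fun ω => (Y ω, W ω)) - entropy' μ W := by
  have : Nonempty Ω := nonempty_of_isProbabilityMeasure μ
  have : Nonempty δ := this.map Y
  have : Nonempty α := (‹Nonempty Ω›).map W
  obtain ⟨g, hg⟩ := (Function.factorsThrough_iff _).1 hV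
  obtain ⟨φ, hφ⟩ := (Function.factorsThrough_iff _).1 hZ
  have hYW : IndepFun (fun ω => (Y ω, W ω)) X μ := by
    rw [hφ]
    exact h.comp (φ := φ) (ψ := id) (measurable_of_finite φ) measurable_id
  have hWX : IndepFun W X μ := hYW.comp (φ := Prod.snd) (ψ := id) measurable_snd measurable_id
  have e1 := entropy'_prod_sub_of_indepFun μ hX hYW (fun p x => g (p.2, x))
  have e2 := entropy'_prod_sub_of_indepFun μ hX hWX (fun w x => g (w, x))
  have hVg : ∀ ω, V ω = g (W ω, X ω) := fun ω => congrFun hg ω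
  simp only [← hVg] at e1 e2
  rw [Fintype.sum_prod_type_right] at e1
  simp only [← Finset.sum_mul, sum_pmfOf_prod μ hY hW] at e1
  have e3 : entropy' μ (fun ω => (Y ω, W ω, V ω)) = entropy' μ (fun ω => ((Y ω, W ω), V ω)) :=
    entropy'_congr μ fun ω ω' => by simp [and_assoc]
  linarith

/-- Finite-valued random variables whose joint mass function factors are independent. -/
theorem indepFun_of_factor {Ω α β : Type*} [MeasurableSpace Ω]
    [Fintype α] [MeasurableSpace α] [MeasurableSingletonClass α]
    [Fintype β] [MeasurableSpace β] [MeasurableSingletonClass β]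
    (μ : Measure Ω) [IsProbabilityMeasure μ] {X : Ω → α} {Z : Ω → β}
    (hX : Measurable X) (hZ : Measurable Z) (a : α → ENNReal) (b : β → ENNReal)
    (h : ∀ x z, μ {ω | X ω = x ∧ Z ω = z} = a x * b z) : IndepFun X Z μ := by
  classical
  have hpX : ∀ x, μ {ω | X ω = x} = a x * ∑ z, b z := by
    intro x
    rw [Finset.mul_sum, ← Finset.sum_congr rfl fun z _ => h x z, ← measure_biUnion_finset]
    · congr 1
      ext ω
      simp
    · intro c _ d _ hcd
      refine Set.disjoint_left.2 fun ω h1 h2 => hcd ?_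
      exact h1.2.symm.trans h2.2
    · intro z _
      exact (hX (measurableSet_singleton x)).inter (hZ (measurableSet_singleton z))
  have hpZ : ∀ z, μ {ω | Z ω = z} = (∑ x, a x) * b z := by
    intro z
    rw [Finset.sum_mul, ← Finset.sum_congr rfl fun x _ => h x z, ← measure_biUnion_finset]
    · congr 1
      ext ω
      simp
    · intro c _ d _ hcd
      refine Set.disjoint_left.2 fun ω h1 h2 => hcd ?_
      exact h1.1.symm.trans h2.1
    · intro x _
      exact (hX (measurableSet_singleton x)).inter (hZ (measurableSet_singleton z))
  have htot : (∑ x, a x) * ∑ z, b z = 1 := by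
    rw [Finset.sum_mul, ← Finset.sum_congr rfl fun x _ => hpX x, ← measure_biUnion_finset]
    · rw [← measure_univ (μ := μ)]
      congr 1
      ext ω
      simp
    · intro c _ d _ hcd
      refine Set.disjoint_left.2 fun ω h1 h2 => hcd ?_
      exact h1.symm.trans h2
    · intro x _
      exact hX (measurableSet_singleton x)
  rw [indepFun_iff_map_prod_eq_prod_map_map hX.aemeasurable hZ.aemeasurable]
  refine Measure.ext_of_singleton fun p => ?_
  obtain ⟨x, z⟩ := p
  rw [← Set.singleton_prod_singleton, Measure.prod_prod, Set.singleton_prod_singleton,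
    Measure.map_apply (hX.prodMk hZ) (measurableSet_singleton _),
    Measure.map_apply hX (measurableSet_singleton _),
    Measure.map_apply hZ (measurableSet_singleton _)]
  have e1 : (fun ω => (X ω, Z ω)) ⁻¹' {(x, z)} = {ω | X ω = x ∧ Z ω = z} := by
    ext ω
    simp
  have e2 : X ⁻¹' {x} = {ω | X ω = x} := rfl
  have e3 : Z ⁻¹' {z} = {ω | Z ω = z} := rfl
  rw [e1, e2, e3, h, hpX, hpZ]
  calc a x * b z = a x * b z * ((∑ x, a x) * ∑ z, b z) := by rw [htot, mul_one]
    _ = _ := by ring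

theorem exists_extend_fin {α : Type*} [Nonempty α] {t : ℕ} (v : Fin t → α) :
    ∃ w : ℕ → α, ∀ i : Fin t, w i = v i :=
  ⟨fun n => if h : n < t then v ⟨n, h⟩ else Classical.arbitrary α, fun i => by simp⟩

/-- The agent state is determined by the initial state, the observations and the randomness. -/
theorem agentState_eq {Ω 𝒪 𝒰 Ξ : Type*} {O : ℕ → Ω → 𝒪} {U : ℕ → Ω → 𝒰} {ξ : ℕ → Ω → Ξ}
    {f : ℕ → 𝒰 → 𝒪 → Ξ → 𝒰} {n : ℕ}
    (hupdate : ∀ j, j < n → ∀ ω, U (j + 1) ω = f j (U j ω) (O (j + 1) ω) (ξ j ω))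
    {ω ω' : Ω} (h0 : U 0 ω = U 0 ω') (hO : ∀ i < n, O (i + 1) ω = O (i + 1) ω')
    (hξ : ∀ i < n, ξ i ω = ξ i ω') : U n ω = U n ω' := by
  induction n with
  | zero => exact h0
  | succ n ih =>
    rw [hupdate n n.lt_succ_self, hupdate n n.lt_succ_self, hO n n.lt_succ_self,
      hξ n n.lt_succ_self, ih (fun j hj => hupdate j (hj.trans n.lt_succ_self))
        (fun i hi => hO i (hi.trans n.lt_succ_self)) (fun i hi => hξ i (hi.trans n.lt_succ_self))]

/-- Under the agent-state property (each agent state is computed from the previous agent state,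
the new observation, and independent algorithmic randomness), the informational error decomposes
into forgetting and implasticity terms at every lag:
`I(Y; H_{1:t} | U_t) = Σ_{k=0}^{t−1} [ I(Y; U_{t−k−1} | U_{t−k}, H_{t−k:t})
                                      + I(Y; O_{t−k} | U_{t−k}, H_{t−k+1:t}) ]`. -/
theorem forgetting_implasticity_decomposition
    {Ω 𝒴 𝒪 𝒰 Ξ : Type*} [MeasurableSpace Ω]
    [Fintype 𝒴] [Nonempty 𝒴] [MeasurableSpace 𝒴] [MeasurableSingletonClass 𝒴]
    [Fintype 𝒪] [Nonempty 𝒪] [MeasurableSpace 𝒪] [MeasurableSingletonClass 𝒪]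
    [Fintype 𝒰] [Nonempty 𝒰] [MeasurableSpace 𝒰] [MeasurableSingletonClass 𝒰]
    [Fintype Ξ] [Nonempty Ξ] [MeasurableSpace Ξ] [MeasurableSingletonClass Ξ]
    (μ : Measure Ω) [IsProbabilityMeasure μ]
    (t : ℕ) (ht : 1 ≤ t)
    (Y : Ω → 𝒴) (O : ℕ → Ω → 𝒪) (U : ℕ → Ω → 𝒰) (ξ : ℕ → Ω → Ξ)
    (hYm : Measurable Y) (hOm : ∀ i, Measurable (O i)) (hUm : ∀ i, Measurable (U i))
    (hξm : ∀ i, Measurable (ξ i))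
    -- the agent-state update: `U_{j+1} = f_j (U_j, O_{j+1}, ξ_j)`
    (f : ℕ → 𝒰 → 𝒪 → Ξ → 𝒰)
    (hupdate : ∀ j, j < t → ∀ ω, U (j + 1) ω = f j (U j ω) (O (j + 1) ω) (ξ j ω))
    -- `U_0, ξ_0, …, ξ_{t−1}` are mutually independent and jointly independent of
    -- `(O_1, …, O_t, Y)`
    (hindep : ∀ (u0 : 𝒰) (e : ℕ → Ξ) (o : ℕ → 𝒪) (y : 𝒴),
      μ {ω | U 0 ω = u0 ∧ (∀ j < t, ξ j ω = e j)
              ∧ (∀ i, 1 ≤ i → i ≤ t → O i ω = o i) ∧ Y ω = y}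
        = μ {ω | U 0 ω = u0} * (∏ j ∈ Finset.range t, μ {ω | ξ j ω = e j})
            * μ {ω | (∀ i, 1 ≤ i → i ≤ t → O i ω = o i) ∧ Y ω = y}) :
    cmi' μ Y (fun ω => fun i : Fin t => O (1 + (i : ℕ)) ω) (U t)
      = ∑ k ∈ Finset.range t,
          (cmi' μ Y (U (t - k - 1))
              (fun ω => (U (t - k) ω, fun i : Fin (k + 1) => O (t - k + (i : ℕ)) ω))
            + cmi' μ Y (O (t - k))
                (fun ω => (U (t - k) ω, fun i : Fin k => O (t - k + 1 + (i : ℕ)) ω))) := by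
  classical
  have hHm : Measurable (fun ω => fun i : Fin t => O (1 + (i : ℕ)) ω) :=
    measurable_pi_lambda _ fun i => hOm _
  have hξm' : Measurable (fun ω => fun i : Fin t => ξ i ω) :=
    measurable_pi_lambda _ fun i => hξm _
  have hHeq : ∀ (w : Fin t → 𝒪) (w' : ℕ → 𝒪), (∀ i : Fin t, w' i = w i) → ∀ ω,
      ((fun i : Fin t => O (1 + (i : ℕ)) ω) = w ↔
        ∀ i, 1 ≤ i → i ≤ t → O i ω = (fun n => w' (n - 1)) i) := by
    intro w w' hw ω
    constructor
    · rintro rfl i h1 h2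
      have := hw ⟨i - 1, by omega⟩
      simp only at this ⊢
      rw [this]
      congr 1
      omega
    · intro h
      funext i
      rw [h (1 + i) (by omega) (by omega), ← hw i]
      simp
  have hRand : IndepFun (fun ω => (Y ω, fun i : Fin t => O (1 + (i : ℕ)) ω))
      (fun ω => (U 0 ω, fun i : Fin t => ξ i ω)) μ := by
    refine (indepFun_of_factor μ ((hUm 0).prodMk hξm')
      (hYm.prodMk hHm)
      (fun p => μ {ω | U 0 ω = p.1} * ∏ j : Fin t, μ {ω | ξ j ω = p.2 j})
      (fun q => μ {ω | (fun i : Fin t => O (1 + (i : ℕ)) ω) = q.2 ∧ Y ω = q.1}) ?_).symm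
    rintro ⟨u, e⟩ ⟨y, o⟩
    obtain ⟨e', he⟩ := exists_extend_fin e
    obtain ⟨o', ho⟩ := exists_extend_fin o
    have := hindep u e' (fun n => o' (n - 1)) y
    simp only [← hHeq o o' ho] at this
    rw [Finset.prod_range] at this
    simp only [he] at this
    rw [← this]
    congr 1
    ext ω
    have h1 : (fun i : Fin t => ξ i ω) = e ↔ ∀ j < t, ξ j ω = e' j := by
      simp only [funext_iff, ← he, Fin.forall_iff]
    simp only [Prod.mk.injEq, Set.mem_ofPred_eq, h1]
    tauto
  have hStep : ∀ j : Fin t, IndepFun (fun ω => (U 0 ω, (fun i : {i : Fin t // i ≠ j} => ξ i ω),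
      Y ω, fun i : Fin t => O (1 + (i : ℕ)) ω)) (ξ j) μ := by
    intro j
    refine (indepFun_of_factor μ (hξm j) ((hUm 0).prodMk
      ((measurable_pi_lambda (fun ω => fun i : {i : Fin t // i ≠ j} => ξ i ω)
        fun i => hξm i).prodMk (hYm.prodMk hHm)))
      (fun x => μ {ω | ξ j ω = x})
      (fun q => μ {ω | U 0 ω = q.1} * (∏ i : {i : Fin t // i ≠ j}, μ {ω | ξ i ω = q.2.1 i})
        * μ {ω | (fun i : Fin t => O (1 + (i : ℕ)) ω) = q.2.2.2 ∧ Y ω = q.2.2.1}) ?_).symm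
    rintro x ⟨u, e, y, o⟩
    obtain ⟨e', he⟩ := exists_extend_fin (fun i => if h : i ≠ j then e ⟨i, h⟩ else x)
    have hej : e' j = x := by simp [he]
    have hei : ∀ i : {i : Fin t // i ≠ j}, e' i = e i := fun i => by simp [he, i.2]
    obtain ⟨o', ho⟩ := exists_extend_fin o
    have := hindep u e' (fun n => o' (n - 1)) y
    simp only [← hHeq o o' ho] at this
    rw [Finset.prod_range, Fintype.prod_eq_mul_prod_subtype_ne _ j] at this
    simp only [hei, hej] at this
    have h1 : ∀ ω, (∀ j < t, ξ j ω = e' j) ↔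
        ξ j ω = x ∧ (fun i : {i : Fin t // i ≠ j} => ξ i ω) = e := by
      intro ω
      rw [funext_iff]
      simp only [← hei, ← hej]
      constructor
      · exact fun h => ⟨h _ j.2, fun i => h _ i.1.2⟩
      · rintro ⟨h2, h3⟩ i hi
        by_cases hij : (⟨i, hi⟩ : Fin t) = j
        · subst hij
          exact h2
        · exact h3 ⟨_, hij⟩
    refine (congrArg μ ?_).trans (this.trans (by ring))
    ext ω
    simp only [Prod.mk.injEq, Set.mem_ofPred_eq, h1]
    tauto
  -- the future observations are part of the full history
  have hTail : ∀ ω ω', (fun i : Fin t => O (1 + (i : ℕ)) ω) = (fun i : Fin t => O (1 + (i : ℕ)) ω') →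
      ∀ i, 1 ≤ i → i ≤ t → O i ω = O i ω' := by
    intro ω ω' h i h1 h2
    have := congrFun h ⟨i - 1, by omega⟩
    simpa only [show 1 + (i - 1) = i by omega] using this
  have hFinal : ∀ n ≤ t,
      entropy' μ (fun ω => (Y ω, (fun i : Fin t => O (1 + (i : ℕ)) ω), U n ω))
        - entropy' μ (fun ω => ((fun i : Fin t => O (1 + (i : ℕ)) ω), U n ω))
      = entropy' μ (fun ω => (Y ω, fun i : Fin t => O (1 + (i : ℕ)) ω))
        - entropy' μ (fun ω => fun i : Fin t => O (1 + (i : ℕ)) ω) := by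
    intro n hn
    refine entropy'_markov μ hYm hHm
      ((hUm 0).prodMk hξm') hRand (fun _ _ h => h) ?_
    intro ω ω' h
    simp only [Prod.mk.injEq] at h
    exact agentState_eq (fun j hj => hupdate j (hj.trans_le hn)) h.2.1
      (fun i hi => hTail ω ω' h.1 _ (by omega) (by omega))
      (fun i hi => congrFun h.2.2 ⟨i, by omega⟩)
  have hBack : ∀ k < t,
      entropy' μ (fun ω => (Y ω, (U (t - k - 1) ω, fun i : Fin (k + 1) => O (t - k + (i : ℕ)) ω),
          U (t - k) ω))
        - entropy' μ (fun ω => ((U (t - k - 1) ω, fun i : Fin (k + 1) => O (t - k + (i : ℕ)) ω),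
          U (t - k) ω))
      = entropy' μ (fun ω => (Y ω, (U (t - k - 1) ω,
          fun i : Fin (k + 1) => O (t - k + (i : ℕ)) ω)))
        - entropy' μ (fun ω => (U (t - k - 1) ω,
          fun i : Fin (k + 1) => O (t - k + (i : ℕ)) ω)) := by
    intro k hk
    refine entropy'_markov μ hYm ((hUm _).prodMk (measurable_pi_lambda _ fun i => hOm _))
      (hξm _) (hStep ⟨t - k - 1, by omega⟩) ?_ ?_
    · intro ω ω' h
      simp only [Prod.mk.injEq] at h ⊢
      obtain ⟨h0, hξ, hy, hO⟩ := h
      refine ⟨hy, agentState_eq (fun j hj => hupdate j (by omega)) h0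
        (fun i hi => hTail ω ω' hO _ (by omega) (by omega))
        (fun i hi => congrFun hξ ⟨⟨i, by omega⟩, ?_⟩), ?_⟩
      · intro h
        have := congrArg Fin.val h
        simp only at this
        omega
      · funext i
        exact hTail ω ω' hO _ (by omega) (by omega)
    · intro ω ω' h
      simp only [Prod.mk.injEq] at h
      obtain ⟨⟨hu, hO⟩, hx⟩ := h
      have hO0 : O (t - k) ω = O (t - k) ω' := by simpa using congrFun hO 0
      have hs : t - k - 1 + 1 = t - k := by omega
      have h1 := hupdate (t - k - 1) (by omega) ω
      have h2 := hupdate (t - k - 1) (by omega) ω'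
      rw [hs] at h1 h2
      rw [h1, h2, hu, hO0, hx]
  set g : ℕ → ℝ := fun k =>
    entropy' μ (fun ω => (Y ω, U (t - k) ω, fun i : Fin k => O (t - k + 1 + (i : ℕ)) ω))
      - entropy' μ (fun ω => (U (t - k) ω, fun i : Fin k => O (t - k + 1 + (i : ℕ)) ω)) with hg
  have hcons : ∀ m k : ℕ, ∀ ω ω', ((fun i : Fin (k + 1) => O (m + (i : ℕ)) ω)
      = fun i : Fin (k + 1) => O (m + (i : ℕ)) ω') ↔ (O m ω = O m ω' ∧
        (fun i : Fin k => O (m + 1 + (i : ℕ)) ω) = fun i : Fin k => O (m + 1 + (i : ℕ)) ω') := by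
    intro m k ω ω'
    simp only [funext_iff, Fin.forall_fin_succ, Fin.val_zero, Fin.val_succ, add_zero]
    simp only [add_assoc, add_comm 1]
  have hterm : ∀ k ∈ Finset.range t,
      cmi' μ Y (U (t - k - 1))
          (fun ω => (U (t - k) ω, fun i : Fin (k + 1) => O (t - k + (i : ℕ)) ω))
        + cmi' μ Y (O (t - k))
          (fun ω => (U (t - k) ω, fun i : Fin k => O (t - k + 1 + (i : ℕ)) ω))
      = g k - g (k + 1) := by
    intro k hk
    have hk : k < t := Finset.mem_range.1 hk
    have hb := hBack k hk
    have hs : t - (k + 1) + 1 = t - k := by omega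
    have hs' : t - (k + 1) = t - k - 1 := by omega
    simp only [hg, hs, cmi']
    rw [hs']
    have e1 : entropy' μ (fun ω => (O (t - k) ω, U (t - k) ω,
        fun i : Fin k => O (t - k + 1 + (i : ℕ)) ω)) = entropy' μ (fun ω => (U (t - k) ω,
        fun i : Fin (k + 1) => O (t - k + (i : ℕ)) ω)) :=
      entropy'_congr μ fun ω ω' => by
        simp only [Prod.mk.injEq, hcons]
        tauto
    have e2 : entropy' μ (fun ω => (Y ω, O (t - k) ω, U (t - k) ω,
        fun i : Fin k => O (t - k + 1 + (i : ℕ)) ω)) = entropy' μ (fun ω => (Y ω, U (t - k) ω,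
        fun i : Fin (k + 1) => O (t - k + (i : ℕ)) ω)) :=
      entropy'_congr μ fun ω ω' => by
        simp only [Prod.mk.injEq, hcons]
        tauto
    have e3 : entropy' μ (fun ω => (Y ω, U (t - k - 1) ω, U (t - k) ω,
        fun i : Fin (k + 1) => O (t - k + (i : ℕ)) ω)) = entropy' μ (fun ω => (Y ω,
        (U (t - k - 1) ω, fun i : Fin (k + 1) => O (t - k + (i : ℕ)) ω), U (t - k) ω)) :=
      entropy'_congr μ fun ω ω' => by
        simp only [Prod.mk.injEq]
        tauto
    have e4 : entropy' μ (fun ω => (U (t - k - 1) ω, U (t - k) ω,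
        fun i : Fin (k + 1) => O (t - k + (i : ℕ)) ω)) = entropy' μ (fun ω => (
        (U (t - k - 1) ω, fun i : Fin (k + 1) => O (t - k + (i : ℕ)) ω), U (t - k) ω)) :=
      entropy'_congr μ fun ω ω' => by
        simp only [Prod.mk.injEq]
        tauto
    linarith
  rw [Finset.sum_congr rfl hterm, Finset.sum_range_sub']
  have g0 : g 0 = entropy' μ (fun ω => (Y ω, U t ω)) - entropy' μ (U t) := by
    simp only [hg]
    congr 1 <;>
    exact entropy'_congr μ fun ω ω' => by simp [funext_iff]
  have gt : g t = entropy' μ (fun ω => (Y ω, (fun i : Fin t => O (1 + (i : ℕ)) ω), U 0 ω))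
      - entropy' μ (fun ω => ((fun i : Fin t => O (1 + (i : ℕ)) ω), U 0 ω)) := by
    simp only [hg, Nat.sub_self, zero_add]
    congr 1 <;>
    exact entropy'_congr μ fun ω ω' => by
      simp only [Prod.mk.injEq]
      tauto
  have f0 := hFinal 0 (Nat.zero_le t)
  have ft := hFinal t le_rfl
  rw [g0, gt, cmi']
  linarith
end

section
/- For every fixed integer t ≥ 1, the cumulative forgetting error over lags equals a single conditional mutual information with the future: Σ_{k=0}^{t} I(Y_{t+k+1}; U_{t−1} | U_t, H_{t:t+k}) = I(H_{t+1:2t+1}; U_{t−1} | U_t, O_t). -/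
open MeasureTheory

open ProbabilityTheory

lemma pmfOf_eq_zero_of_notMem_range {Ω α : Type*} [MeasurableSpace Ω] (μ : Measure Ω)
    {X : Ω → α} {x : α} (hx : x ∉ Set.range X) : pmfOf μ X x = 0 := by
  have h : X ⁻¹' {x} = ∅ := Set.preimage_singleton_eq_empty.mpr hx
  simp [pmfOf, h]

/-- Two random variables generating the same partition of the sample space have equal entropy. -/
lemma entropy'_congr_of_eq_iff_eq {Ω α β : Type*} [MeasurableSpace Ω] [Fintype α] [Fintype β]
    (μ : Measure Ω) (X : Ω → α) (Z : Ω → β) (h : ∀ ω ω', X ω = X ω' ↔ Z ω = Z ω') :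
    entropy' μ X = entropy' μ Z := by
  have key : ∀ ω, pmfOf μ X (X ω) = pmfOf μ Z (Z ω) := fun ω => by
    have : X ⁻¹' {X ω} = Z ⁻¹' {Z ω} := by
      ext ω'
      simpa using h ω' ω
    simp only [pmfOf, this]
  have hX : ∀ x, Real.negMulLog (pmfOf μ X x) ≠ 0 → ∃ ω, X ω = x := fun x hx => by
    by_contra hn
    exact hx (by rw [pmfOf_eq_zero_of_notMem_range μ hn, Real.negMulLog_zero])
  have hZ : ∀ z, Real.negMulLog (pmfOf μ Z z) ≠ 0 → ∃ ω, Z ω = z := fun z hz => by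
    by_contra hn
    exact hz (by rw [pmfOf_eq_zero_of_notMem_range μ hn, Real.negMulLog_zero])
  refine Finset.sum_bij_ne_zero (fun x _ hx => Z (hX x hx).choose) (by simp) ?_ ?_ ?_
  · intro x _ hx x' _ hx' hxx
    rw [← (hX x hx).choose_spec, ← (hX x' hx').choose_spec]
    exact (h _ _).mpr hxx
  · intro z _ hz
    obtain ⟨ω, rfl⟩ := hZ z hz
    rw [← key] at hz
    exact ⟨X ω, Finset.mem_univ _, hz, (h _ _).mp (hX _ hz).choose_spec⟩
  · intro x _ hx
    rw [← key, (hX x hx).choose_spec]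

lemma sum_pmfOf {Ω α : Type*} [MeasurableSpace Ω] [Fintype α] [MeasurableSpace α]
    [MeasurableSingletonClass α] (μ : Measure Ω) [IsProbabilityMeasure μ]
    {X : Ω → α} (hX : Measurable X) : ∑ x, pmfOf μ X x = 1 := by
  have := sum_measureReal_preimage_singleton (μ := μ) (f := X) Finset.univ
    (fun x _ => hX (measurableSet_singleton x))
  simpa [pmfOf, Measure.real] using this

/-- Entropy is additive over independent random variables. -/
lemma entropy'_prodMk_of_indepFun {Ω α β : Type*} [MeasurableSpace Ω]
    [Fintype α] [MeasurableSpace α] [MeasurableSingletonClass α]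
    [Fintype β] [MeasurableSpace β] [MeasurableSingletonClass β]
    (μ : Measure Ω) [IsProbabilityMeasure μ] {X : Ω → α} {Z : Ω → β}
    (hX : Measurable X) (hZ : Measurable Z) (h : IndepFun X Z μ) :
    entropy' μ (fun ω => (X ω, Z ω)) = entropy' μ X + entropy' μ Z := by
  have hp : ∀ x z, pmfOf μ (fun ω => (X ω, Z ω)) (x, z) = pmfOf μ X x * pmfOf μ Z z := by
    intro x z
    have h1 := h.measure_inter_preimage_eq_mul {x} {z} (measurableSet_singleton x)
      (measurableSet_singleton z)
    have h2 : (fun ω => (X ω, Z ω)) ⁻¹' {(x, z)} = X ⁻¹' {x} ∩ Z ⁻¹' {z} := by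
      ext ω
      simp
    simp [pmfOf, h2, h1]
  simp only [entropy', Fintype.sum_prod_type, hp, Real.negMulLog_mul, Finset.sum_add_distrib,
    ← Finset.sum_mul, ← Finset.mul_sum, sum_pmfOf μ hX, sum_pmfOf μ hZ, one_mul]

/-- Factorization of point masses implies independence of finite-valued random variables. -/
lemma indepFun_of_measure_singleton {Ω α β : Type*} [MeasurableSpace Ω]
    [Fintype α] [MeasurableSpace α] [MeasurableSingletonClass α]
    [Fintype β] [MeasurableSpace β] [MeasurableSingletonClass β]
    (μ : Measure Ω) [IsProbabilityMeasure μ] {X : Ω → α} {Z : Ω → β}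
    (hX : Measurable X) (hZ : Measurable Z)
    (h : ∀ x z, μ {ω | X ω = x ∧ Z ω = z} = μ {ω | X ω = x} * μ {ω | Z ω = z}) :
    IndepFun X Z μ := by
  rw [indepFun_iff_map_prod_eq_prod_map_map hX.aemeasurable hZ.aemeasurable]
  refine Measure.ext_of_singleton fun ⟨x, z⟩ => ?_
  rw [Measure.map_apply (hX.prodMk hZ) (measurableSet_singleton _), ← Set.singleton_prod_singleton,
    Measure.prod_prod, Measure.map_apply hX (measurableSet_singleton _),
    Measure.map_apply hZ (measurableSet_singleton _)]
  exact h x z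

/-- Entropy of a variable `V` joined with a window of observations `(Y, X)` splits off the last
input if that input is independent of everything else. -/
lemma entropy'_prodMk_window_succ {Ω α 𝒳 𝒴 : Type*} [MeasurableSpace Ω]
    [Fintype α] [MeasurableSpace α] [MeasurableSingletonClass α]
    [Fintype 𝒳] [MeasurableSpace 𝒳] [MeasurableSingletonClass 𝒳]
    [Fintype 𝒴] [MeasurableSpace 𝒴] [MeasurableSingletonClass 𝒴]
    (μ : Measure Ω) [IsProbabilityMeasure μ] (t k : ℕ) {V : Ω → α} {X : ℕ → Ω → 𝒳}
    {Y : ℕ → Ω → 𝒴} (hV : Measurable V) (hX : ∀ i, Measurable (X i)) (hY : ∀ i, Measurable (Y i))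
    (h : IndepFun (X (t + k + 1))
      (fun ω => (Y (t + k + 1) ω, V ω, fun i : Fin (k + 1) => (Y (t + i) ω, X (t + i) ω))) μ) :
    entropy' μ (fun ω => (V ω, fun i : Fin (k + 1 + 1) => (Y (t + i) ω, X (t + i) ω)))
      = entropy' μ (X (t + k + 1)) + entropy' μ
        (fun ω => (Y (t + k + 1) ω, V ω, fun i : Fin (k + 1) => (Y (t + i) ω, X (t + i) ω))) := by
  rw [← entropy'_prodMk_of_indepFun μ (hX _) (by fun_prop) h]
  refine entropy'_congr_of_eq_iff_eq μ _ _ fun ω ω' => ?_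
  simp only [Prod.mk.injEq, funext_iff, Fin.forall_fin_succ' (n := k + 1), Fin.val_castSucc,
    Fin.val_last, ← add_assoc]
  tauto

lemma forall_le_eq_ofNat_iff {β : Type*} {n : ℕ} (f : ℕ → β) (g : Fin (n + 1) → β) :
    (∀ i ≤ n, f i = g (Fin.ofNat _ i)) ↔ (fun i : Fin (n + 1) => f i) = g := by
  rw [funext_iff, Fin.forall_iff]
  refine forall_congr' fun i => ⟨fun h hi => ?_, fun h hi => ?_⟩
  · rw [h (by omega)]
    congr 1
    exact Fin.ext (Nat.mod_eq_of_lt hi)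
  · rw [h (by omega)]
    congr 1
    exact Fin.ext (Nat.mod_eq_of_lt (by omega)).symm

/-- For every fixed integer `t ≥ 1`, assuming each input `X_{s+1}` is independent of
`(U_0, …, U_s, O_0, …, O_s, Y_{s+1})` (where `O_i = (Y_i, X_i)`), the cumulative forgetting
error over lags equals a single conditional mutual information with the future:
`Σ_{k=0}^{t} I(Y_{t+k+1}; U_{t−1} | U_t, H_{t:t+k}) = I(H_{t+1:2t+1}; U_{t−1} | U_t, O_t)`. -/
theorem cumulative_forgetting_error
    {Ω 𝒳 𝒴 𝒰 : Type*} [MeasurableSpace Ω]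
    [Fintype 𝒳] [Nonempty 𝒳] [MeasurableSpace 𝒳] [MeasurableSingletonClass 𝒳]
    [Fintype 𝒴] [Nonempty 𝒴] [MeasurableSpace 𝒴] [MeasurableSingletonClass 𝒴]
    [Fintype 𝒰] [Nonempty 𝒰] [MeasurableSpace 𝒰] [MeasurableSingletonClass 𝒰]
    (μ : Measure Ω) [IsProbabilityMeasure μ]
    (t : ℕ) (ht : 1 ≤ t)
    (X : ℕ → Ω → 𝒳) (Y : ℕ → Ω → 𝒴) (U : ℕ → Ω → 𝒰)
    (hXm : ∀ i, Measurable (X i)) (hYm : ∀ i, Measurable (Y i)) (hUm : ∀ i, Measurable (U i))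
    (hindep : ∀ (s : ℕ) (x : 𝒳) (u : ℕ → 𝒰) (o : ℕ → 𝒴 × 𝒳) (y : 𝒴),
      μ {ω | X (s + 1) ω = x ∧ ((∀ i ≤ s, U i ω = u i)
              ∧ (∀ i ≤ s, (Y i ω, X i ω) = o i) ∧ Y (s + 1) ω = y)}
        = μ {ω | X (s + 1) ω = x}
            * μ {ω | (∀ i ≤ s, U i ω = u i)
                  ∧ (∀ i ≤ s, (Y i ω, X i ω) = o i) ∧ Y (s + 1) ω = y}) :
    ∑ k ∈ Finset.range (t + 1),
        cmi' μ (Y (t + k + 1)) (U (t - 1))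
          (fun ω => (U t ω, fun i : Fin (k + 1) => (Y (t + (i : ℕ)) ω, X (t + (i : ℕ)) ω)))
      = cmi' μ (fun ω => fun i : Fin (t + 1) => (Y (t + 1 + (i : ℕ)) ω, X (t + 1 + (i : ℕ)) ω))
          (U (t - 1)) (fun ω => (U t ω, (Y t ω, X t ω))) := by
  have hind : ∀ k, IndepFun (X (t + k + 1)) (fun ω => (Y (t + k + 1) ω, (U (t - 1) ω, U t ω),
      fun i : Fin (k + 1) => (Y (t + i) ω, X (t + i) ω))) μ := by
    intro k
    have hpast : IndepFun (X (t + k + 1)) (fun ω => (fun i : Fin (t + k + 1) => U i ω,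
        fun i : Fin (t + k + 1) => (Y i ω, X i ω), Y (t + k + 1) ω)) μ := by
      refine indepFun_of_measure_singleton μ (hXm _) (by fun_prop) ?_
      rintro x ⟨u, o, y⟩
      have hs := hindep (t + k) x (fun i => u (Fin.ofNat _ i)) (fun i => o (Fin.ofNat _ i)) y
      have hiff : ∀ ω, (fun i : Fin (t + k + 1) => U i ω,
          fun i : Fin (t + k + 1) => (Y i ω, X i ω), Y (t + k + 1) ω) = (u, o, y) ↔
          (∀ i ≤ t + k, U i ω = u (Fin.ofNat _ i)) ∧
            (∀ i ≤ t + k, (Y i ω, X i ω) = o (Fin.ofNat _ i)) ∧ Y (t + k + 1) ω = y := fun ω => by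
        rw [forall_le_eq_ofNat_iff (fun i => U i ω) u,
          forall_le_eq_ofNat_iff (fun i => (Y i ω, X i ω)) o, Prod.mk.injEq, Prod.mk.injEq]
      simpa only [hiff] using hs
    exact hpast.comp (ψ := fun w => (w.2.2, (w.1 ⟨t - 1, by omega⟩, w.1 ⟨t, by omega⟩),
      fun i : Fin (k + 1) => w.2.1 ⟨t + i, by omega⟩)) measurable_id .of_discrete
  have hind' : ∀ k, IndepFun (X (t + k + 1)) (fun ω => (Y (t + k + 1) ω, U t ω,
      fun i : Fin (k + 1) => (Y (t + i) ω, X (t + i) ω))) μ := fun k =>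
    (hind k).comp (ψ := fun w : 𝒴 × (𝒰 × 𝒰) × (Fin (k + 1) → 𝒴 × 𝒳) => (w.1, w.2.1.2, w.2.2))
      measurable_id .of_discrete
  let A : ℕ → ℝ := fun k => entropy' μ (fun ω => ((U (t - 1) ω, U t ω),
    fun i : Fin (k + 1) => (Y (t + i) ω, X (t + i) ω)))
  let B : ℕ → ℝ := fun k => entropy' μ (fun ω => (U t ω,
    fun i : Fin (k + 1) => (Y (t + i) ω, X (t + i) ω)))
  have hterm : ∀ k, cmi' μ (Y (t + k + 1)) (U (t - 1))
      (fun ω => (U t ω, fun i : Fin (k + 1) => (Y (t + (i : ℕ)) ω, X (t + (i : ℕ)) ω)))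
      = (B (k + 1) - A (k + 1)) - (B k - A k) := by
    intro k
    have hA1 : A (k + 1) = _ := entropy'_prodMk_window_succ μ t k
      ((hUm (t - 1)).prodMk (hUm t)) hXm hYm (hind k)
    have hB1 : B (k + 1) = _ := entropy'_prodMk_window_succ μ t k (hUm t) hXm hYm (hind' k)
    have hA0 : A k = entropy' μ (fun ω => (U (t - 1) ω, U t ω,
        fun i : Fin (k + 1) => (Y (t + i) ω, X (t + i) ω))) :=
      entropy'_congr_of_eq_iff_eq μ _ _ fun _ _ => by simp only [Prod.mk.injEq, and_assoc]
    have hA2 : entropy' μ (fun ω => (Y (t + k + 1) ω, (U (t - 1) ω, U t ω),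
        fun i : Fin (k + 1) => (Y (t + i) ω, X (t + i) ω)))
        = entropy' μ (fun ω => (Y (t + k + 1) ω, U (t - 1) ω, U t ω,
        fun i : Fin (k + 1) => (Y (t + i) ω, X (t + i) ω))) :=
      entropy'_congr_of_eq_iff_eq μ _ _ fun _ _ => by simp only [Prod.mk.injEq, and_assoc]
    rw [hA1, hB1, hA0, hA2, cmi']
    ring
  have hshift : ∀ i : Fin (t + 1), t + ((i : ℕ) + 1) = t + 1 + i := fun i => by ring
  have hA0 : A 0 = entropy' μ (fun ω => (U (t - 1) ω, U t ω, (Y t ω, X t ω))) :=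
    entropy'_congr_of_eq_iff_eq μ _ _ fun _ _ => by simp [funext_iff, and_assoc]
  have hB0 : B 0 = entropy' μ (fun ω => (U t ω, (Y t ω, X t ω))) :=
    entropy'_congr_of_eq_iff_eq μ _ _ fun _ _ => by simp [funext_iff]
  have hA1 : A (t + 1) = entropy' μ (fun ω =>
      (fun i : Fin (t + 1) => (Y (t + 1 + i) ω, X (t + 1 + i) ω),
        U (t - 1) ω, U t ω, (Y t ω, X t ω))) :=
    entropy'_congr_of_eq_iff_eq μ _ _ fun _ _ => by
      simp only [Prod.mk.injEq, funext_iff, Fin.forall_fin_succ (n := t + 1), Fin.val_succ,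
        Fin.val_zero, add_zero, hshift]
      tauto
  have hB1 : B (t + 1) = entropy' μ (fun ω =>
      (fun i : Fin (t + 1) => (Y (t + 1 + i) ω, X (t + 1 + i) ω), U t ω, (Y t ω, X t ω))) :=
    entropy'_congr_of_eq_iff_eq μ _ _ fun _ _ => by
      simp only [Prod.mk.injEq, funext_iff, Fin.forall_fin_succ (n := t + 1), Fin.val_succ,
        Fin.val_zero, add_zero, hshift]
      tauto
  rw [Finset.sum_congr rfl fun k _ => hterm k, Finset.sum_range_sub (fun k => B k - A k), hA0, hB0,
    hA1, hB1, cmi']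
  ring
end

section
/- Suppose β ∈ (0,1) satisfies β ≠ η and β + 1/β = η + 1/η + 1/(σ²η) − η/σ², and set α = 1 − β. Define for each integer k ≥ 0 the covariance expression C_k = α σ² β^k + (α(1 − η²)/(η − β)) · ( η^{k+1}/(1 − η²) − β^{k+1}/(1 − ηβ) ). Then η · C_k = C_{k+1} for all k ≥ 0; consequently C_k = η^k C_0 for all k ≥ 0. -/
/-- The steady-state covariance `C_k = E[U_{t+k} Y_t]` between the LMS agent state and a label
`k` steps in the past, for stepsize `α = 1 − β`:
`C_k = ασ²β^k + (α(1 − η²)/(η − β))·(η^{k+1}/(1 − η²) − β^{k+1}/(1 − ηβ))`. -/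
noncomputable def lmsCov (η σ β : ℝ) (k : ℕ) : ℝ :=
  (1 - β) * σ ^ 2 * β ^ k
    + (1 - β) * (1 - η ^ 2) / (η - β)
      * (η ^ (k + 1) / (1 - η ^ 2) - β ^ (k + 1) / (1 - η * β))

/-- Clearing denominators in the optimality equation for the stepsize. -/
theorem sq_mul_sub_mul_one_sub_eq {η σ β : ℝ} (hη : η ≠ 0) (hσ : σ ≠ 0) (hβ : β ≠ 0)
    (heq : β + 1 / β = η + 1 / η + 1 / (σ ^ 2 * η) - η / σ ^ 2) :
    σ ^ 2 * ((η - β) * (1 - η * β)) = β * (1 - η ^ 2) := by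
  field_simp at heq
  linear_combination heq

/-- Under the optimality equation the `β ^ k` terms of the covariance cancel. -/
theorem lmsCov_eq_mul_pow {η σ β : ℝ} (hη : 1 - η ^ 2 ≠ 0) (hηβ : 1 - η * β ≠ 0)
    (hsub : η - β ≠ 0) (h : σ ^ 2 * ((η - β) * (1 - η * β)) = β * (1 - η ^ 2)) (k : ℕ) :
    lmsCov η σ β k = (1 - β) / (η - β) * η ^ (k + 1) := by
  have hσ : σ ^ 2 = β * (1 - η ^ 2) / ((η - β) * (1 - η * β)) :=
    eq_div_of_mul_eq (mul_ne_zero hsub hηβ) h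
  rw [lmsCov, hσ]
  field_simp
  ring

/-- Suppose `β ∈ (0,1)` satisfies `β ≠ η` and `β + 1/β = η + 1/η + 1/(σ²η) − η/σ²`, and set
`α = 1 − β`.  Then `η·C_k = C_{k+1}` for all `k ≥ 0`; consequently `C_k = η^k C_0` for all
`k ≥ 0`. -/
theorem optimal_stepsize_covariance_proportionality
    (η σ β : ℝ) (hη : η ∈ Set.Ioo (0 : ℝ) 1) (hσ : 0 < σ)
    (hβ : β ∈ Set.Ioo (0 : ℝ) 1) (hβη : β ≠ η)
    (heq : β + 1 / β = η + 1 / η + 1 / (σ ^ 2 * η) - η / σ ^ 2) :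
    (∀ k : ℕ, η * lmsCov η σ β k = lmsCov η σ β (k + 1))
    ∧ (∀ k : ℕ, lmsCov η σ β k = η ^ k * lmsCov η σ β 0) := by
  have hne : 1 - η ^ 2 ≠ 0 := (by nlinarith [hη.1, hη.2] : 0 < 1 - η ^ 2).ne'
  have hηβ : 1 - η * β ≠ 0 := (by nlinarith [hη.1, hη.2, hβ.1, hβ.2] : 0 < 1 - η * β).ne'
  have hC := lmsCov_eq_mul_pow hne hηβ (sub_ne_zero.mpr hβη.symm)
    (sq_mul_sub_mul_one_sub_eq hη.1.ne' hσ.ne' hβ.1.ne' heq)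
  constructor <;> intro k <;> simp only [hC] <;> ring
end

section
/- For all real numbers a and b, letting p = e^a/(1 + e^a) and q = e^b/(1 + e^b), the Kullback–Leibler divergence between the corresponding Bernoulli distributions satisfies p·ln(p/q) + (1 − p)·ln((1 − p)/(1 − q)) ≤ (a − b)². -/
/-- The convex function `x ↦ ln (1 + eˣ)` lies above its tangent line at `b`. -/
theorem logistic_mul_sub_le_log_one_add_exp_sub (a b : ℝ) :
    (Real.exp b / (1 + Real.exp b)) * (a - b)
      ≤ Real.log (1 + Real.exp a) - Real.log (1 + Real.exp b) := by
  have hb : 0 < Real.exp b := Real.exp_pos b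
  have ha : 0 < Real.exp a := Real.exp_pos a
  rw [← Real.log_div (by positivity) (by positivity), Real.le_log_iff_exp_le (by positivity)]
  have h := convexOn_exp.2 (Set.mem_univ 0) (Set.mem_univ (a - b))
    (show 0 ≤ 1 / (1 + Real.exp b) by positivity)
    (show 0 ≤ Real.exp b / (1 + Real.exp b) by positivity) (by field_simp)
  simp only [smul_eq_mul, mul_zero, zero_add, Real.exp_zero, mul_one] at h
  refine h.trans_eq ?_
  rw [Real.exp_sub]
  field_simp

/-- The logistic function is `1`-Lipschitz, stated for ordered arguments. -/
theorem logistic_sub_logistic_le_sub {a b : ℝ} (hab : b ≤ a) :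
    Real.exp a / (1 + Real.exp a) - Real.exp b / (1 + Real.exp b) ≤ a - b := by
  have hb : 0 < Real.exp b := Real.exp_pos b
  have ha : 0 < Real.exp a := Real.exp_pos a
  have h : Real.exp b = Real.exp a * Real.exp (b - a) := by
    rw [← Real.exp_add, add_sub_cancel]
  have hsub : Real.exp a - Real.exp b ≤ Real.exp a * (a - b) := by
    nlinarith [Real.add_one_le_exp (b - a)]
  rw [div_sub_div _ _ (by positivity) (by positivity), div_le_iff₀ (by positivity)]
  nlinarith [mul_nonneg (sub_nonneg.2 hab) hb.le,
    mul_nonneg (sub_nonneg.2 hab) (mul_pos ha hb).le]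

/-- The Kullback–Leibler divergence between Bernoulli distributions in terms of their logits. -/
theorem bernoulli_logit_kl_eq (a b : ℝ) :
    (Real.exp a / (1 + Real.exp a))
        * Real.log ((Real.exp a / (1 + Real.exp a)) / (Real.exp b / (1 + Real.exp b)))
      + (1 - Real.exp a / (1 + Real.exp a))
        * Real.log ((1 - Real.exp a / (1 + Real.exp a)) / (1 - Real.exp b / (1 + Real.exp b)))
      = (Real.exp a / (1 + Real.exp a)) * (a - b)
        - (Real.log (1 + Real.exp a) - Real.log (1 + Real.exp b)) := by
  have one_sub_logistic (x : ℝ) : 1 - Real.exp x / (1 + Real.exp x) = 1 / (1 + Real.exp x) := by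
    have := Real.exp_pos x
    field_simp
    ring
  have hb : 0 < Real.exp b := Real.exp_pos b
  have ha : 0 < Real.exp a := Real.exp_pos a
  have hp : Real.log (1 - Real.exp a / (1 + Real.exp a)) = -Real.log (1 + Real.exp a) := by
    rw [one_sub_logistic, one_div, Real.log_inv]
  have hq : Real.log (1 - Real.exp b / (1 + Real.exp b)) = -Real.log (1 + Real.exp b) := by
    rw [one_sub_logistic, one_div, Real.log_inv]
  rw [Real.log_div (x := 1 - _) (by rw [one_sub_logistic]; positivity)
      (by rw [one_sub_logistic]; positivity), hp, hq,
    Real.log_div (by positivity) (by positivity), Real.log_div ha.ne' (by positivity),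
    Real.log_div hb.ne' (by positivity), Real.log_exp, Real.log_exp]
  ring

/-- For all real numbers `a` and `b`, letting `p = eᵃ/(1 + eᵃ)` and `q = eᵇ/(1 + eᵇ)`, the
Kullback–Leibler divergence between the corresponding Bernoulli distributions satisfies
`p·ln(p/q) + (1 − p)·ln((1 − p)/(1 − q)) ≤ (a − b)²`. -/
theorem bernoulli_logit_kl_le_sq (a b : ℝ) :
    (Real.exp a / (1 + Real.exp a))
        * Real.log ((Real.exp a / (1 + Real.exp a)) / (Real.exp b / (1 + Real.exp b)))
      + (1 - Real.exp a / (1 + Real.exp a))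
        * Real.log ((1 - Real.exp a / (1 + Real.exp a)) / (1 - Real.exp b / (1 + Real.exp b)))
      ≤ (a - b) ^ 2 := by
  rw [bernoulli_logit_kl_eq]
  have h := logistic_mul_sub_le_log_one_add_exp_sub a b
  rcases le_total b a with hab | hab
  · nlinarith [mul_nonneg (sub_nonneg.2 hab) (sub_nonneg.2 (logistic_sub_logistic_le_sub hab))]
  · nlinarith [mul_nonneg (sub_nonneg.2 hab) (sub_nonneg.2 (logistic_sub_logistic_le_sub hab))]
end
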